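/- Let 0 ≤ a < b ≤ 1 and β ∈ ℝ, and suppose {a_n}, {b_n}, {q_n} are sequences with a_n, b_n ∈ {1,…,n}, q_n > 0, lim_{n→∞} a_n/n = a, lim_{n→∞} b_n/n = b, and lim_{n→∞} n(1−q_n) = β. Then for any intervals A = [y₁,y₂] ⊆ [0,1] and B = [y₃,y₄] ⊆ [0,1], lim_{n→∞} ( E_{μ_{n,q_n}}[ 1_A(π(a_n)/n)·1_B(π(b_n)/n) ] − E_{μ_{n,q_n}}[ 1_A(π(a_n)/n) ]·E_{μ_{n,q_n}}[ 1_B(π(b_n)/n) ] ) = 0. -/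

import Mathlib

open Filter Finset MeasureTheory

/-- Number of inversions of a permutation of `Fin n`. -/
def inversions (n : ℕ) (π : Equiv.Perm (Fin n)) : ℕ :=
  (Finset.univ.filter (fun p : Fin n × Fin n => p.1 < p.2 ∧ π p.2 < π p.1)).card

/-- The `(n,q)`-Mallows probability mass function on `S_n`. -/
noncomputable def mallowsPMF (n : ℕ) (q : ℝ) (π : Equiv.Perm (Fin n)) : ℝ :=
  q ^ inversions n π / ∑ σ : Equiv.Perm (Fin n), q ^ inversions n σ

open Classical in
/-- The `(n,q)`-Mallows probability of an event `P` of permutations. -/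
noncomputable def mallowsProb (n : ℕ) (q : ℝ) (P : Equiv.Perm (Fin n) → Prop) : ℝ :=
  ∑ π : Equiv.Perm (Fin n), if P π then mallowsPMF n q π else 0

/-- Expectation with respect to the `(n,q)`-Mallows measure. -/
noncomputable def mallowsExp (n : ℕ) (q : ℝ) (f : Equiv.Perm (Fin n) → ℝ) : ℝ :=
  ∑ π : Equiv.Perm (Fin n), mallowsPMF n q π * f π

/-- Action of a permutation of `Fin n` on one-based indices `{1,…,n}`. -/
def permAct (n : ℕ) (π : Equiv.Perm (Fin n)) (i : ℕ) : ℕ :=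
  if h : 1 ≤ i ∧ i ≤ n then ((π ⟨i - 1, by omega⟩ : Fin n) : ℕ) + 1 else i

/-- The limiting density `u(x,y,β)` from Starr's theorem. -/
noncomputable def mallowsU (x y β : ℝ) : ℝ :=
  if β = 0 then 1
  else (β / 2) * Real.sinh (β / 2) /
    (Real.exp (β / 4) * Real.cosh (β * (x - y) / 2)
      - Real.exp (-β / 4) * Real.cosh (β * (x + y - 1) / 2)) ^ 2

/-! ### Inserting a first value into a permutation -/

/-- The permutation of `Fin (N + 1)` sending `0` to `p` whose remaining values are in the same
relative order as those of `σ`. -/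
def insertHead {N : ℕ} (p : Fin (N + 1)) (σ : Equiv.Perm (Fin N)) : Equiv.Perm (Fin (N + 1)) :=
  (finSuccEquiv N).trans ((Equiv.optionCongr σ).trans (finSuccEquiv' p).symm)

@[simp] lemma insertHead_zero {N : ℕ} (p : Fin (N + 1)) (σ : Equiv.Perm (Fin N)) :
    insertHead p σ 0 = p := by
  simp [insertHead]

@[simp] lemma insertHead_succ {N : ℕ} (p : Fin (N + 1)) (σ : Equiv.Perm (Fin N)) (i : Fin N) :
    insertHead p σ i.succ = p.succAbove (σ i) := by
  simp [insertHead]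

lemma val_insertHead_succ {N : ℕ} (p : Fin (N + 1)) (σ : Equiv.Perm (Fin N)) (i : Fin N) :
    (insertHead p σ i.succ : ℕ) = if (σ i : ℕ) < p then (σ i : ℕ) else σ i + 1 := by
  rw [insertHead_succ, Fin.succAbove]
  simp only [Fin.lt_def, Fin.val_castSucc]
  split_ifs <;> simp

lemma insertHead_bijective (N : ℕ) :
    Function.Bijective (fun x : Fin (N + 1) × Equiv.Perm (Fin N) => insertHead x.1 x.2) := by
  rw [Fintype.bijective_iff_injective_and_card]
  refine ⟨?_, by simp [Fintype.card_perm, Nat.factorial_succ]⟩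
  rintro ⟨p, σ⟩ ⟨p', σ'⟩ h
  have h0 : p = p' := by simpa using DFunLike.congr_fun h 0
  subst h0
  simp only [Prod.mk.injEq, true_and]
  ext i
  have hi := DFunLike.congr_fun h i.succ
  simp only [insertHead_succ, Fin.succAbove_right_inj] at hi
  rw [hi]

lemma sum_perm_succ {N : ℕ} (F : Equiv.Perm (Fin (N + 1)) → ℝ) :
    ∑ π, F π = ∑ p : Fin (N + 1), ∑ σ : Equiv.Perm (Fin N), F (insertHead p σ) := by
  rw [← (insertHead_bijective N).sum_comp F, Fintype.sum_prod_type]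

lemma inversions_eq_sum (n : ℕ) (π : Equiv.Perm (Fin n)) :
    inversions n π = ∑ i, ∑ j, if i < j ∧ π j < π i then 1 else 0 := by
  rw [inversions, Finset.card_filter, Fintype.sum_prod_type]

lemma inversions_insertHead {N : ℕ} (p : Fin (N + 1)) (σ : Equiv.Perm (Fin N)) :
    inversions (N + 1) (insertHead p σ) = p + inversions N σ := by
  have h1 : ∑ j : Fin N, (if p.succAbove (σ j) < p then 1 else 0) = (p : ℕ) := by
    rw [Equiv.sum_comp σ (fun x => if p.succAbove x < p then 1 else 0)]
    have h := Fin.sum_univ_succAbove (fun y : Fin (N + 1) => if y < p then 1 else 0) p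
    rw [← Finset.card_filter] at h
    simpa [Finset.filter_gt_eq_Iio] using h.symm
  rw [inversions_eq_sum, inversions_eq_sum, Fin.sum_univ_succ, Fin.sum_univ_succ]
  simp only [Fin.sum_univ_succ, insertHead_zero, insertHead_succ, Fin.succ_pos, lt_self_iff_false,
    Fin.not_lt_zero, Fin.succ_lt_succ_iff, Fin.succAbove_lt_succAbove_iff, true_and, false_and,
    if_false, zero_add, h1]

/-! ### Expectations -/

lemma partition_pos (n : ℕ) {q : ℝ} (hq : 0 < q) :
    0 < ∑ σ : Equiv.Perm (Fin n), q ^ inversions n σ :=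
  Finset.sum_pos (fun _ _ => pow_pos hq _) Finset.univ_nonempty

lemma mallowsPMF_nonneg (n : ℕ) {q : ℝ} (hq : 0 < q) (π : Equiv.Perm (Fin n)) :
    0 ≤ mallowsPMF n q π :=
  div_nonneg (pow_pos hq _).le (partition_pos n hq).le

lemma mallowsExp_const (n : ℕ) {q : ℝ} (hq : 0 < q) (c : ℝ) :
    mallowsExp n q (fun _ => c) = c := by
  simp only [mallowsExp, mallowsPMF]
  rw [← Finset.sum_mul, ← Finset.sum_div, div_self (partition_pos n hq).ne', one_mul]

lemma mallowsExp_mono (n : ℕ) {q : ℝ} (hq : 0 < q) {f g : Equiv.Perm (Fin n) → ℝ}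
    (h : ∀ π, f π ≤ g π) : mallowsExp n q f ≤ mallowsExp n q g :=
  Finset.sum_le_sum fun π _ => mul_le_mul_of_nonneg_left (h π) (mallowsPMF_nonneg n hq π)

lemma mallowsExp_nonneg (n : ℕ) {q : ℝ} (hq : 0 < q) {f : Equiv.Perm (Fin n) → ℝ}
    (h : ∀ π, 0 ≤ f π) : 0 ≤ mallowsExp n q f :=
  Finset.sum_nonneg fun π _ => mul_nonneg (mallowsPMF_nonneg n hq π) (h π)

lemma mallowsExp_sub (n : ℕ) (q : ℝ) (f g : Equiv.Perm (Fin n) → ℝ) :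
    mallowsExp n q (fun π => f π - g π) = mallowsExp n q f - mallowsExp n q g := by
  simp only [mallowsExp, mul_sub, Finset.sum_sub_distrib]

lemma mallowsExp_neg (n : ℕ) (q : ℝ) (f : Equiv.Perm (Fin n) → ℝ) :
    mallowsExp n q (fun π => -f π) = -mallowsExp n q f := by
  simp only [mallowsExp, mul_neg, Finset.sum_neg_distrib]

lemma abs_mallowsExp_sub_le (n : ℕ) {q : ℝ} (hq : 0 < q) {f g h : Equiv.Perm (Fin n) → ℝ}
    (H : ∀ π, |f π - g π| ≤ h π) :
    |mallowsExp n q f - mallowsExp n q g| ≤ mallowsExp n q h := by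
  rw [← mallowsExp_sub, abs_le, ← mallowsExp_neg]
  exact ⟨mallowsExp_mono n hq fun π => (abs_le.1 (H π)).1,
    mallowsExp_mono n hq fun π => (abs_le.1 (H π)).2⟩

/-- The law of the first value of a Mallows permutation of `Fin N`. -/
noncomputable def headWeight (N : ℕ) (q : ℝ) (p : Fin N) : ℝ :=
  q ^ (p : ℕ) / ∑ r : Fin N, q ^ (r : ℕ)

lemma headWeight_nonneg (N : ℕ) {q : ℝ} (hq : 0 < q) (p : Fin N) : 0 ≤ headWeight N q p :=
  div_nonneg (pow_pos hq _).le (Finset.sum_nonneg fun _ _ => (pow_pos hq _).le)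

lemma sum_headWeight (N : ℕ) {q : ℝ} (hq : 0 < q) : ∑ p, headWeight (N + 1) q p = 1 := by
  simp only [headWeight]
  rw [← Finset.sum_div]
  exact div_self (Finset.sum_pos (fun _ _ => pow_pos hq _) Finset.univ_nonempty).ne'

lemma mallowsExp_succ (N : ℕ) (q : ℝ) (f : Equiv.Perm (Fin (N + 1)) → ℝ) :
    mallowsExp (N + 1) q f =
      ∑ p, headWeight (N + 1) q p * mallowsExp N q (fun σ => f (insertHead p σ)) := by
  have hZ : ∑ σ : Equiv.Perm (Fin (N + 1)), q ^ inversions (N + 1) σ =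
      (∑ r : Fin (N + 1), q ^ (r : ℕ)) * ∑ σ : Equiv.Perm (Fin N), q ^ inversions N σ := by
    simp only [sum_perm_succ, inversions_insertHead, pow_add, Finset.sum_mul_sum]
  simp only [mallowsExp, mallowsPMF, headWeight]
  rw [sum_perm_succ]
  refine Finset.sum_congr rfl fun p _ => ?_
  rw [Finset.mul_sum]
  refine Finset.sum_congr rfl fun σ _ => ?_
  rw [inversions_insertHead, hZ, pow_add, mul_div_mul_comm, mul_assoc]

/-! ### Point probabilities -/

lemma inversions_swap_mul_le {N : ℕ} (v v' : Fin N) (π : Equiv.Perm (Fin N)) :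
    inversions N (Equiv.swap v v' * π) ≤ inversions N π + 4 * N := by
  classical
  set T : Finset (Fin N) := {π.symm v, π.symm v'} with hT
  have hTc : T.card ≤ 2 := Finset.card_le_two
  have hsub : (Finset.univ.filter fun p : Fin N × Fin N =>
        p.1 < p.2 ∧ (Equiv.swap v v' * π) p.2 < (Equiv.swap v v' * π) p.1) ⊆
      (Finset.univ.filter fun p : Fin N × Fin N => p.1 < p.2 ∧ π p.2 < π p.1) ∪
        (T ×ˢ Finset.univ ∪ Finset.univ ×ˢ T) := by
    rintro ⟨i, j⟩ h
    simp only [Finset.mem_union, Finset.mem_filter, Finset.mem_univ, true_and,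
      Finset.mem_product, and_true] at h ⊢
    by_cases hi : i ∈ T
    · exact Or.inr (Or.inl hi)
    by_cases hj : j ∈ T
    · exact Or.inr (Or.inr hj)
    have key : ∀ k, k ∉ T → (Equiv.swap v v' * π) k = π k := by
      intro k hk
      simp only [hT, Finset.mem_insert, Finset.mem_singleton, not_or, Equiv.eq_symm_apply] at hk
      exact Equiv.swap_apply_of_ne_of_ne hk.1 hk.2
    rw [key i hi, key j hj] at h
    exact Or.inl h
  refine (Finset.card_le_card hsub).trans ((Finset.card_union_le _ _).trans ?_)
  refine Nat.add_le_add_left ((Finset.card_union_le _ _).trans ?_) _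
  rw [Finset.card_product, Finset.card_product, Finset.card_univ, Fintype.card_fin]
  nlinarith

lemma pow_le_pow_mul_pow {q r : ℝ} (hq : 0 < q) (hr : 1 ≤ r) (hqr : q ≤ r) (hqr' : 1 ≤ q * r)
    {a b k : ℕ} (hab : a ≤ b + k) (hba : b ≤ a + k) : q ^ a ≤ r ^ k * q ^ b := by
  rcases le_total a b with h | h
  · obtain ⟨d, rfl⟩ := Nat.exists_eq_add_of_le h
    have hd : d ≤ k := by omega
    calc q ^ a = 1 * q ^ a := (one_mul _).symm
      _ ≤ (q * r) ^ d * q ^ a := by gcongr; exact one_le_pow₀ hqr'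
      _ = r ^ d * q ^ (a + d) := by rw [mul_pow, pow_add]; ring
      _ ≤ r ^ k * q ^ (a + d) := by gcongr
  · obtain ⟨d, rfl⟩ := Nat.exists_eq_add_of_le h
    have hd : d ≤ k := by omega
    calc q ^ (b + d) = q ^ d * q ^ b := by rw [pow_add]; ring
      _ ≤ r ^ d * q ^ b := by gcongr
      _ ≤ r ^ k * q ^ b := by gcongr

lemma mallowsExp_point_le {N : ℕ} {q r : ℝ} (hq : 0 < q) (hr : 1 ≤ r) (hqr : q ≤ r)
    (hqr' : 1 ≤ q * r) (j v : Fin N) :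
    N * mallowsExp N q (fun σ => if σ j = v then 1 else 0) ≤ r ^ (4 * N) := by
  have hcmp : ∀ v', mallowsExp N q (fun σ => if σ j = v then 1 else 0) ≤
      r ^ (4 * N) * mallowsExp N q (fun σ => if σ j = v' then 1 else 0) := by
    intro v'
    simp only [mallowsExp]
    rw [← Equiv.sum_comp (Equiv.mulLeft (Equiv.swap v v')), Finset.mul_sum]
    refine Finset.sum_le_sum fun σ _ => ?_
    have hiff : (Equiv.mulLeft (Equiv.swap v v') σ) j = v ↔ σ j = v' := by
      rw [Equiv.coe_mulLeft, Equiv.Perm.mul_apply, Equiv.swap_apply_eq_iff, Equiv.swap_apply_left]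
    simp only [hiff]
    split_ifs
    · rw [mul_one, mul_one, mallowsPMF, mallowsPMF, ← mul_div_assoc, Equiv.coe_mulLeft]
      refine div_le_div_of_nonneg_right ?_ (partition_pos N hq).le
      refine pow_le_pow_mul_pow hq hr hqr hqr' (inversions_swap_mul_le v v' σ) ?_
      have := inversions_swap_mul_le v v' (Equiv.swap v v' * σ)
      rwa [← mul_assoc, Equiv.swap_mul_self, one_mul] at this
    · simp
  have hsum : ∑ v', mallowsExp N q (fun σ => if σ j = v' then 1 else 0) = 1 := by
    simp only [mallowsExp]
    rw [Finset.sum_comm]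
    refine Eq.trans (Finset.sum_congr rfl fun σ _ => ?_) (mallowsExp_const N hq 1)
    rw [← Finset.mul_sum]
    simp
  calc N * mallowsExp N q (fun σ => if σ j = v then 1 else 0)
      = ∑ _v' : Fin N, mallowsExp N q (fun σ => if σ j = v then 1 else 0) := by simp
    _ ≤ ∑ v', r ^ (4 * N) * mallowsExp N q (fun σ => if σ j = v' then 1 else 0) :=
        Finset.sum_le_sum fun v' _ => hcmp v'
    _ = r ^ (4 * N) := by rw [← Finset.mul_sum, hsum, mul_one]

/-! ### Covariances -/

/-- Covariance with respect to the Mallows measure. -/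
noncomputable def mallowsCov (n : ℕ) (q : ℝ) (f g : Equiv.Perm (Fin n) → ℝ) : ℝ :=
  mallowsExp n q (fun π => f π * g π) - mallowsExp n q f * mallowsExp n q g

lemma sum_cov_le {ι : Type*} [Fintype ι] {w x y : ι → ℝ} (hw : ∀ i, 0 ≤ w i)
    (hw1 : ∑ i, w i = 1) {c D t : ℝ} (ht : 0 < t) (hy : ∀ i, |y i - c| ≤ D) :
    ∑ i, w i * (x i * y i) - (∑ i, w i * x i) * ∑ i, w i * y i ≤
      t * (∑ i, w i * (x i * x i) - (∑ i, w i * x i) * ∑ i, w i * x i) + D ^ 2 / (4 * t) := by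
  set X := ∑ i, w i * x i with hX
  have hxy : ∑ i, w i * ((x i - X) * (y i - c)) =
      ∑ i, w i * (x i * y i) - X * ∑ i, w i * y i := by
    calc _ = ∑ i, (w i * (x i * y i) - c * (w i * x i) - X * (w i * y i) + X * c * w i) :=
          Finset.sum_congr rfl fun i _ => by ring
      _ = _ := by
          simp only [Finset.sum_add_distrib, Finset.sum_sub_distrib, ← Finset.mul_sum, ← hX, hw1]
          ring
  have hxx : ∑ i, w i * ((x i - X) * (x i - X)) = ∑ i, w i * (x i * x i) - X * X := by
    calc _ = ∑ i, (w i * (x i * x i) - 2 * X * (w i * x i) + X * X * w i) :=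
          Finset.sum_congr rfl fun i _ => by ring
      _ = _ := by
          simp only [Finset.sum_add_distrib, Finset.sum_sub_distrib, ← Finset.mul_sum, ← hX, hw1]
          ring
  rw [← hxy, ← hxx]
  calc ∑ i, w i * ((x i - X) * (y i - c))
      ≤ ∑ i, (t * (w i * ((x i - X) * (x i - X))) + D ^ 2 / (4 * t) * w i) := by
        refine Finset.sum_le_sum fun i _ => ?_
        have h1 : (y i - c) ^ 2 ≤ D ^ 2 := sq_le_sq' (abs_le.1 (hy i)).1 (abs_le.1 (hy i)).2
        have h2 : (x i - X) * (y i - c) ≤ t * ((x i - X) * (x i - X)) + D ^ 2 / (4 * t) := by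
          rw [← sub_le_iff_le_add', le_div_iff₀ (by positivity)]
          nlinarith [sq_nonneg (2 * t * (x i - X) - (y i - c))]
        calc _ ≤ w i * (t * ((x i - X) * (x i - X)) + D ^ 2 / (4 * t)) :=
              mul_le_mul_of_nonneg_left h2 (hw i)
          _ = _ := by ring
    _ = _ := by rw [Finset.sum_add_distrib, ← Finset.mul_sum, ← Finset.mul_sum, hw1, mul_one]

/-- Law of total covariance, conditioning on the first value. -/
lemma mallowsCov_succ (N : ℕ) (q : ℝ) (f g : Equiv.Perm (Fin (N + 1)) → ℝ) :
    mallowsCov (N + 1) q f g =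
      ∑ p, headWeight (N + 1) q p *
        mallowsCov N q (fun σ => f (insertHead p σ)) (fun σ => g (insertHead p σ)) +
      (∑ p, headWeight (N + 1) q p * (mallowsExp N q (fun σ => f (insertHead p σ)) *
          mallowsExp N q (fun σ => g (insertHead p σ))) -
        (∑ p, headWeight (N + 1) q p * mallowsExp N q (fun σ => f (insertHead p σ))) *
          ∑ p, headWeight (N + 1) q p * mallowsExp N q (fun σ => g (insertHead p σ))) := by
  simp only [mallowsCov, mallowsExp_succ, mul_sub, Finset.sum_sub_distrib]
  ring

lemma abs_indicator_shift_sub_le {z : ℕ} (hz : 1 ≤ z) (a p : ℕ) :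
    |(if (if a < p then a else a + 1) < z then (1 : ℝ) else 0) - if a < z then 1 else 0| ≤
      if a = z - 1 then 1 else 0 := by
  split_ifs <;> first | omega | norm_num

/-- If `f` depends only on the first `m ≤ j` values, and the point probabilities of the smaller
Mallows measures are at most `D`, then `f` is nearly uncorrelated with the events `σ j < z`. -/
lemma mallowsCov_lt_le {q t D : ℝ} (hq : 0 < q) (ht : 0 < t) (m : ℕ) :
    ∀ (N : ℕ) (f : Equiv.Perm (Fin N) → ℝ),
      (∀ σ τ : Equiv.Perm (Fin N), (∀ k : Fin N, (k : ℕ) < m → σ k = τ k) → f σ = f τ) →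
      (∀ N', N - m ≤ N' → N' < N → ∀ j v : Fin N',
        mallowsExp N' q (fun σ => if σ j = v then 1 else 0) ≤ D) →
      ∀ (j : Fin N) (z : ℕ), m ≤ j →
      mallowsCov N q f (fun σ => if (σ j : ℕ) < z then 1 else 0) ≤
        t * mallowsCov N q f f + m * (D ^ 2 / (4 * t)) := by
  induction m with
  | zero =>
    intro N f hf _ j z _
    have hf' : f = fun _ => f 1 := funext fun σ => hf σ 1 (by simp)
    rw [hf']
    have h1 : mallowsExp N q (fun σ => f 1 * if (σ j : ℕ) < z then 1 else 0) =
        f 1 * mallowsExp N q (fun σ => if (σ j : ℕ) < z then 1 else 0) := by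
      simp only [mallowsExp, Finset.mul_sum]
      exact Finset.sum_congr rfl fun _ _ => by ring
    simp only [mallowsCov, h1, mallowsExp_const N hq]
    simp
  | succ m ih =>
    intro N f hf hD j z hj
    obtain _ | N := N
    · exact j.elim0
    obtain ⟨j, rfl⟩ : ∃ i : Fin N, j = i.succ :=
      Fin.exists_succ_eq.2 (by rintro rfl; simp at hj) |>.imp fun _ h => h.symm
    have hw := headWeight_nonneg (N + 1) hq
    have hw1 := sum_headWeight N hq
    simp only [Fin.val_succ, add_le_add_iff_right] at hj
    have hdiff : ∀ p : Fin (N + 1),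
        |mallowsExp N q (fun σ => if (insertHead p σ j.succ : ℕ) < z then 1 else 0) -
          mallowsExp N q (fun σ => if (σ j : ℕ) < z then 1 else 0)| ≤ D := by
      intro p
      by_cases hz : 1 ≤ z ∧ z ≤ N
      · refine le_trans (abs_mallowsExp_sub_le N hq fun σ => ?_)
          (hD N (by omega) (by omega) j ⟨z - 1, by omega⟩)
        simp only [val_insertHead_succ, Fin.ext_iff]
        exact abs_indicator_shift_sub_le hz.1 _ _
      · have h0 : 0 ≤ D := (hD N (by omega) (by omega) j j).trans' <|
          mallowsExp_nonneg N hq fun σ => by split_ifs <;> norm_num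
        refine le_trans (abs_mallowsExp_sub_le N hq (h := fun _ => D) fun σ => ?_)
          (mallowsExp_const N hq D).le
        have h1 := (σ j).isLt
        have h2 := (insertHead p σ j.succ).isLt
        have h3 : ((insertHead p σ j.succ : ℕ) < z) = ((σ j : ℕ) < z) :=
          propext ⟨fun _ => by omega, fun _ => by omega⟩
        simpa only [h3, sub_self, abs_zero] using h0
    have hin : ∀ p : Fin (N + 1),
        mallowsCov N q (fun σ => f (insertHead p σ))
            (fun σ => if (insertHead p σ j.succ : ℕ) < z then 1 else 0) ≤
          t * mallowsCov N q (fun σ => f (insertHead p σ)) (fun σ => f (insertHead p σ)) +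
            m * (D ^ 2 / (4 * t)) := by
      intro p
      have hg : (fun σ : Equiv.Perm (Fin N) =>
          if (insertHead p σ j.succ : ℕ) < z then (1 : ℝ) else 0) =
          fun σ => if (σ j : ℕ) < (if (p : ℕ) < z then z - 1 else z) then 1 else 0 := by
        funext σ
        congr 1
        rw [val_insertHead_succ, eq_iff_iff]
        split_ifs <;> omega
      rw [hg]
      refine ih N _ (fun σ τ h => hf _ _ fun k => ?_) (fun N' h1 h2 => hD N' (by omega) (by omega))
        j _ hj
      refine Fin.cases ?_ (fun k hk => ?_) k
      · simp
      · simp only [insertHead_succ]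
        rw [h k (by simpa using hk)]
    have hout := sum_cov_le (x := fun p => mallowsExp N q (fun σ => f (insertHead p σ)))
      hw hw1 ht hdiff
    have hinsum : ∑ p, headWeight (N + 1) q p * mallowsCov N q (fun σ => f (insertHead p σ))
            (fun σ => if (insertHead p σ j.succ : ℕ) < z then 1 else 0) ≤
        t * ∑ p, headWeight (N + 1) q p *
          mallowsCov N q (fun σ => f (insertHead p σ)) (fun σ => f (insertHead p σ)) +
            m * (D ^ 2 / (4 * t)) := by
      calc _ ≤ ∑ p, headWeight (N + 1) q p *
            (t * mallowsCov N q (fun σ => f (insertHead p σ)) (fun σ => f (insertHead p σ)) +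
              m * (D ^ 2 / (4 * t))) :=
            Finset.sum_le_sum fun p _ => mul_le_mul_of_nonneg_left (hin p) (hw p)
        _ = ∑ p, (t * (headWeight (N + 1) q p *
              mallowsCov N q (fun σ => f (insertHead p σ)) (fun σ => f (insertHead p σ))) +
              m * (D ^ 2 / (4 * t)) * headWeight (N + 1) q p) :=
            Finset.sum_congr rfl fun p _ => by ring
        _ = _ := by
            rw [Finset.sum_add_distrib, ← Finset.mul_sum, ← Finset.mul_sum, hw1, mul_one]
    rw [mallowsCov_succ, mallowsCov_succ N q f f]
    push_cast
    linarith

lemma mallowsCov_neg_left (n : ℕ) (q : ℝ) (f g : Equiv.Perm (Fin n) → ℝ) :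
    mallowsCov n q (fun π => -f π) g = -mallowsCov n q f g := by
  simp only [mallowsCov, neg_mul, mallowsExp_neg]
  ring

lemma mallowsCov_sub_right (n : ℕ) (q : ℝ) (f g h : Equiv.Perm (Fin n) → ℝ) :
    mallowsCov n q f (fun π => g π - h π) = mallowsCov n q f g - mallowsCov n q f h := by
  simp only [mallowsCov, mul_sub, mallowsExp_sub]
  ring

lemma abs_mallowsCov_lt_le {n : ℕ} {q r t : ℝ} (hq : 0 < q) (hr : 1 ≤ r) (hqr : q ≤ r)
    (hqr' : 1 ≤ q * r) (ht : 0 < t) {i j : Fin n} (hij : i < j) {F : Fin n → ℝ}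
    (hF0 : ∀ x, 0 ≤ F x) (hF1 : ∀ x, F x ≤ 1) (z : ℕ) :
    |mallowsCov n q (fun σ => F (σ i)) (fun σ => if (σ j : ℕ) < z then 1 else 0)| ≤
      t + n * ((r ^ (4 * n) / (n - (i + 1))) ^ 2 / (4 * t)) := by
  have hij' : (i : ℕ) < j := hij
  have hjn := j.isLt
  have hin : (0 : ℝ) < n - (i + 1) := by
    rw [sub_pos]; exact_mod_cast (by omega : (i : ℕ) + 1 < n)
  have hvar : mallowsCov n q (fun σ => F (σ i)) (fun σ => F (σ i)) ≤ 1 := by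
    refine (sub_le_self _ (mul_self_nonneg _)).trans ?_
    refine (mallowsExp_mono n hq fun σ => ?_).trans (mallowsExp_const n hq 1).le
    exact mul_le_one₀ (hF1 _) (hF0 _) (hF1 _)
  have hD : ∀ N', n - (i + 1) ≤ N' → N' < n → ∀ j v : Fin N',
      mallowsExp N' q (fun σ => if σ j = v then 1 else 0) ≤ r ^ (4 * n) / (n - (i + 1)) := by
    intro N' h1 h2 j' v
    have h3 := mallowsExp_point_le hq hr hqr hqr' j' v
    have h4 : (n : ℝ) - (i + 1) ≤ N' := by
      rw [sub_le_iff_le_add]; exact_mod_cast (by omega : n ≤ N' + (i + 1))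
    have h5 : 0 ≤ mallowsExp N' q (fun σ => if σ j' = v then 1 else 0) :=
      mallowsExp_nonneg N' hq fun σ => by split_ifs <;> norm_num
    rw [le_div_iff₀ hin, mul_comm]
    calc _ ≤ _ := mul_le_mul_of_nonneg_right h4 h5
      _ ≤ r ^ (4 * N') := h3
      _ ≤ r ^ (4 * n) := pow_le_pow_right₀ hr (by omega)
  have hloc : ∀ σ τ : Equiv.Perm (Fin n), (∀ k : Fin n, (k : ℕ) < i + 1 → σ k = τ k) →
      σ i = τ i := fun σ τ h => h i (Nat.lt_succ_self _)
  have hle : ((i + 1 : ℕ) : ℝ) * ((r ^ (4 * n) / (n - (i + 1))) ^ 2 / (4 * t)) ≤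
      n * ((r ^ (4 * n) / (n - (i + 1))) ^ 2 / (4 * t)) := by
    gcongr
    omega
  have hpos := mallowsCov_lt_le hq ht (i + 1) n (fun σ => F (σ i))
    (fun σ τ h => by rw [hloc σ τ h]) hD j z hij'
  have hneg := mallowsCov_lt_le hq ht (i + 1) n (fun σ => -F (σ i))
    (fun σ τ h => by rw [hloc σ τ h]) hD j z hij'
  have hvar' : mallowsCov n q (fun σ => -F (σ i)) (fun σ => -F (σ i)) =
      mallowsCov n q (fun σ => F (σ i)) (fun σ => F (σ i)) := by
    simp only [mallowsCov, neg_mul_neg, mallowsExp_neg]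
  rw [mallowsCov_neg_left, hvar'] at hneg
  have := mul_le_mul_of_nonneg_left hvar ht.le
  rw [abs_le]
  constructor <;> linarith

open Classical in
lemma mallowsProb_eq_mallowsExp (n : ℕ) (q : ℝ) (P : Equiv.Perm (Fin n) → Prop) :
    mallowsProb n q P = mallowsExp n q (fun π => if P π then 1 else 0) := by
  simp [mallowsProb, mallowsExp]

lemma abs_mallowsProb_and_sub_le {n : ℕ} {q r t : ℝ} (hq : 0 < q) (hr : 1 ≤ r) (hqr : q ≤ r)
    (hqr' : 1 ≤ q * r) (ht : 0 < t) {i j : ℕ} (hi : 1 ≤ i) (hij : i < j) (hjn : j ≤ n)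
    {y₃ y₄ : ℝ} (hy₃ : 0 ≤ y₃) (hy : y₃ ≤ y₄) (S : Set ℝ) :
    |mallowsProb n q (fun π => (permAct n π i : ℝ) / n ∈ S ∧
          (permAct n π j : ℝ) / n ∈ Set.Icc y₃ y₄) -
        mallowsProb n q (fun π => (permAct n π i : ℝ) / n ∈ S) *
          mallowsProb n q (fun π => (permAct n π j : ℝ) / n ∈ Set.Icc y₃ y₄)| ≤
      2 * (t + n * ((r ^ (4 * n) / (n - i)) ^ 2 / (4 * t))) := by
  classical
  have hn : (0 : ℝ) < n := by exact_mod_cast (by omega : 0 < n)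
  set i' : Fin n := ⟨i - 1, by omega⟩ with hi'
  set j' : Fin n := ⟨j - 1, by omega⟩ with hj'
  have hpi : ∀ π, permAct n π i = (π i' : ℕ) + 1 := fun π => dif_pos ⟨hi, by omega⟩
  have hpj : ∀ π, permAct n π j = (π j' : ℕ) + 1 := fun π => dif_pos ⟨by omega, hjn⟩
  set F : Fin n → ℝ := fun x => if (((x : ℕ) + 1 : ℕ) : ℝ) / n ∈ S then 1 else 0 with hF
  have hind : ∀ x : ℕ, (if (((x : ℕ) + 1 : ℕ) : ℝ) / n ∈ Set.Icc y₃ y₄ then (1 : ℝ) else 0) =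
      (if x < ⌊y₄ * n⌋₊ then 1 else 0) - if x < ⌈y₃ * n⌉₊ - 1 then 1 else 0 := by
    intro x
    have h1 : (((x : ℕ) + 1 : ℕ) : ℝ) / n ≤ y₄ ↔ x < ⌊y₄ * n⌋₊ := by
      rw [div_le_iff₀ hn, ← Nat.le_floor_iff (by positivity [hy₃.trans hy]), Nat.succ_le_iff]
    have h2 : y₃ ≤ (((x : ℕ) + 1 : ℕ) : ℝ) / n ↔ ¬ x < ⌈y₃ * n⌉₊ - 1 := by
      rw [le_div_iff₀ hn, ← Nat.ceil_le]
      omega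
    have h3 : ⌈y₃ * n⌉₊ ≤ ⌊y₄ * n⌋₊ + 1 :=
      (Nat.ceil_le_floor_add_one _).trans (by gcongr)
    simp only [Set.mem_Icc, h1, h2]
    split_ifs <;> first | omega | norm_num
  have hcov : mallowsProb n q (fun π => (permAct n π i : ℝ) / n ∈ S ∧
          (permAct n π j : ℝ) / n ∈ Set.Icc y₃ y₄) -
        mallowsProb n q (fun π => (permAct n π i : ℝ) / n ∈ S) *
          mallowsProb n q (fun π => (permAct n π j : ℝ) / n ∈ Set.Icc y₃ y₄) =
      mallowsCov n q (fun σ => F (σ i')) (fun σ => if (σ j' : ℕ) < ⌊y₄ * n⌋₊ then 1 else 0) -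
      mallowsCov n q (fun σ => F (σ i'))
        (fun σ => if (σ j' : ℕ) < ⌈y₃ * n⌉₊ - 1 then 1 else 0) := by
    rw [← mallowsCov_sub_right]
    simp only [← hind, mallowsCov, mallowsProb_eq_mallowsExp, hpi, hpj, hF, ite_mul, one_mul,
      zero_mul]
    refine congrArg₂ _ (congrArg _ (funext fun π => ?_))
      (congrArg₂ _ rfl (congrArg _ (funext fun π => ?_))) <;> split_ifs <;> first | rfl | tauto
  have hbound := abs_mallowsCov_lt_le hq hr hqr hqr' ht (i := i') (j := j')
    (Fin.mk_lt_mk.2 (by omega)) (F := F) (fun x => by simp only [hF]; split_ifs <;> simp)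
    (fun x => by simp only [hF]; split_ifs <;> simp)
  have hcast : ((i' : ℕ) : ℝ) + 1 = i := by
    rw [hi']; exact_mod_cast Nat.sub_add_cancel hi
  rw [hcast] at hbound
  rw [hcov, two_mul]
  exact (abs_sub _ _).trans (add_le_add (hbound _) (hbound _))

/-- **Lemma 5.3.** Let `0 ≤ a < b ≤ 1`, `aₙ, bₙ ∈ {1,…,n}` with `aₙ/n → a`, `bₙ/n → b`,
and `n(1-qₙ) → β`. Then for any intervals `A = [y₁,y₂]`, `B = [y₃,y₄]` in `[0,1]`, the
covariance of `1_A(π(aₙ)/n)` and `1_B(π(bₙ)/n)` tends to `0`. -/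
theorem mallows_two_index_asymptotic_independence
    (a b β : ℝ) (ha : 0 ≤ a) (hab : a < b) (hb : b ≤ 1)
    (an bn : ℕ → ℕ)
    (han : ∀ n : ℕ, 1 ≤ n → 1 ≤ an n ∧ an n ≤ n)
    (hbn : ∀ n : ℕ, 1 ≤ n → 1 ≤ bn n ∧ bn n ≤ n)
    (q : ℕ → ℝ) (hq : ∀ n, 0 < q n)
    (haa : Tendsto (fun n : ℕ => (an n : ℝ) / n) atTop (nhds a))
    (hbb : Tendsto (fun n : ℕ => (bn n : ℝ) / n) atTop (nhds b))
    (hβ : Tendsto (fun n : ℕ => (n : ℝ) * (1 - q n)) atTop (nhds β))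
    (y₁ y₂ y₃ y₄ : ℝ)
    (hy₁ : 0 ≤ y₁) (hy₁₂ : y₁ ≤ y₂) (hy₂ : y₂ ≤ 1)
    (hy₃ : 0 ≤ y₃) (hy₃₄ : y₃ ≤ y₄) (hy₄ : y₄ ≤ 1) :
    Tendsto (fun n : ℕ =>
        mallowsProb n (q n) (fun π =>
            (permAct n π (an n) : ℝ) / n ∈ Set.Icc y₁ y₂ ∧
            (permAct n π (bn n) : ℝ) / n ∈ Set.Icc y₃ y₄)
          - mallowsProb n (q n)
              (fun π => (permAct n π (an n) : ℝ) / n ∈ Set.Icc y₁ y₂)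
            * mallowsProb n (q n)
              (fun π => (permAct n π (bn n) : ℝ) / n ∈ Set.Icc y₃ y₄))
      atTop (nhds 0) := by
  set c : ℝ := |β| + 1 with hc
  have hc1 : 1 ≤ c := by rw [hc]; linarith [abs_nonneg β]
  set δ : ℝ := (1 - a) / 2 with hδ
  have hδ0 : 0 < δ := by rw [hδ]; linarith
  set K : ℝ := (Real.exp (8 * c) / δ) ^ 2 / 4 with hK
  have hlim : Tendsto (fun n : ℕ => 2 * (1 + K) / √(n : ℝ)) atTop (nhds 0) :=
    tendsto_const_nhds.div_atTop (Real.tendsto_sqrt_atTop.comp tendsto_natCast_atTop_atTop)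
  refine squeeze_zero_norm' ?_ hlim
  have e1 : ∀ᶠ n : ℕ in atTop, (an n : ℝ) / n < bn n / n := haa.eventually_lt hbb hab
  have e2 : ∀ᶠ n : ℕ in atTop, (an n : ℝ) / n < 1 - δ :=
    haa.eventually_lt_const (by rw [hδ]; linarith)
  have e3 : ∀ᶠ n : ℕ in atTop, |(n : ℝ) * (1 - q n)| < c :=
    hβ.abs.eventually_lt_const (by rw [hc]; linarith)
  filter_upwards [e1, e2, e3, eventually_ge_atTop 1, eventually_ge_atTop ⌈2 * c⌉₊]
    with n h1 h2 h3 hn1 hn2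
  have hn : (0 : ℝ) < n := by exact_mod_cast hn1
  have hnc : 2 * c ≤ n := Nat.ceil_le.1 hn2
  have hlt : an n < bn n := by exact_mod_cast (div_lt_div_iff_of_pos_right hn).1 h1
  have hgap : δ * n ≤ n - an n := by
    rw [div_lt_iff₀ hn] at h2; linarith
  have hx : |1 - q n| ≤ c / n := by
    rw [abs_mul, abs_of_pos hn] at h3
    rw [le_div_iff₀ hn]; linarith
  rw [abs_le] at hx
  set x : ℝ := c / n with hxdef
  have hx0 : 0 < x := by positivity
  have hx2 : x ≤ 1 / 2 := by rw [hxdef, div_le_iff₀ hn]; linarith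
  have hr : (1 : ℝ) ≤ 1 + 2 * x := by linarith
  have hM : (1 + 2 * x) ^ (4 * n) ≤ Real.exp (8 * c) := by
    calc (1 + 2 * x) ^ (4 * n) ≤ Real.exp (2 * x) ^ (4 * n) := by
          gcongr; linarith [Real.add_one_le_exp (2 * x)]
      _ = Real.exp (8 * c) := by
          rw [← Real.exp_nat_mul, hxdef]; congr 1; push_cast; field_simp; ring
  have hs : 0 < √(n : ℝ) := Real.sqrt_pos.2 hn
  have hmain := abs_mallowsProb_and_sub_le (hq n) hr (by linarith) (by nlinarith)
    (t := 1 / √(n : ℝ)) (by positivity) (han n hn1).1 hlt (hbn n hn1).2 hy₃ hy₃₄ (Set.Icc y₁ y₂)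
  rw [Real.norm_eq_abs]
  refine hmain.trans ?_
  calc _ ≤ 2 * (1 / √(n : ℝ) + n * ((Real.exp (8 * c) / (δ * n)) ^ 2 / (4 * (1 / √(n : ℝ))))) := by
        have : 0 < (n : ℝ) - an n := (by positivity : 0 < δ * n).trans_le hgap
        gcongr
    _ = 2 * (1 + K) / √(n : ℝ) := by
        have hsq : (n : ℝ) = √(n : ℝ) ^ 2 := (Real.sq_sqrt hn.le).symm
        rw [hK]
        generalize √(n : ℝ) = s at *
        rw [hsq]
        field_simp
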